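/- Consider the (2+2) GA that in each generation, with probability p_c = 1/2, applies two-point crossover once to its two parents to create two offspring (and otherwise creates two offspring by copying the parents), applies standard bit mutation to the offspring, and then uses fitness sharing with sharing radius σ = n to select the 2 search points amongst the two parents and the two offspring that maximize the shared population fitness. The expected number of fitness evaluations until this GA finds a global optimum of the Ising model on a ring with an even number n of vertices (equivalently, of the 2-coloring problem on this ring) is O(n²). -/

import Mathlib

open Filter
open scoped ENNReal BigOperators Classical

noncomputable section

abbrev BitString (n : ℕ) := Fin n → Bool

def onesCount {n : ℕ} (x : BitString n) : ℕ := (Finset.univ.filter fun i => x i = true).card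

def allOnes (n : ℕ) : BitString n := fun _ => true
def allZeros (n : ℕ) : BitString n := fun _ => false

def twoMax {n : ℕ} (x : BitString n) : ℕ := max (onesCount x) (n - onesCount x)

/-- probability that standard bit mutation with rate `1/n` creates `y` from `x` -/
def mutProb (n : ℕ) (x y : BitString n) : ℝ≥0∞ :=
  ((n : ℝ≥0∞)⁻¹) ^ hammingDist x y * (1 - (n : ℝ≥0∞)⁻¹) ^ (n - hammingDist x y)

/-- distribution of a (time-homogeneous) finite Markov chain after `t` steps -/
def evolve {S : Type*} [Fintype S] (init : S → ℝ≥0∞) (trans : S → S → ℝ≥0∞) : ℕ → S → ℝ≥0∞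
  | 0 => init
  | t + 1 => fun s' => ∑ s, evolve init trans t s * trans s s'

/-- probability of an event under a (sub)distribution -/
def probOf {S : Type*} [Fintype S] (d : S → ℝ≥0∞) (A : S → Prop) : ℝ≥0∞ :=
  ∑ s, if A s then d s else 0

end

noncomputable section

namespace Stmt16

/-- fitness of a coloring of the ring Cₙ: the number of monochromatic edges -/
def isingFit {n : ℕ} (x : BitString n) : ℕ :=
  (Finset.univ.filter fun i : Fin n =>
    x i = x ⟨(i.val + 1) % n, Nat.mod_lt _ i.pos⟩).card

/-- the global optima are the two constant colorings -/
def isOpt {n : ℕ} (x : BitString n) : Prop := x = allZeros n ∨ x = allOnes n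

/-- the sharing function with sharing radius σ = n and Hamming distance:
sh(x,y) = max{0, 1 − H(x,y)/n} -/
def sh {n : ℕ} (x y : BitString n) : ℝ := max 0 (1 - (hammingDist x y : ℝ) / n)

/-- the population fitness f({u,v}) = f(u)/(sh(u,u)+sh(u,v)) + f(v)/(sh(v,u)+sh(v,v)) -/
def popFit {n : ℕ} (u v : BitString n) : ℝ :=
  (isingFit u : ℝ) / (sh u u + sh u v) + (isingFit v : ℝ) / (sh v u + sh v v)

/-- two-point crossover of u and v with cut positions c₁, c₂: the bits strictly
between the two cut positions are exchanged; `swap = false` gives the first offspring,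
`swap = true` the second -/
def twoPoint {n : ℕ} (u v : BitString n) (c₁ c₂ : Fin (n + 1)) (swap : Bool) :
    BitString n := fun i =>
  if min c₁.val c₂.val ≤ i.val ∧ i.val < max c₁.val c₂.val
  then (if swap then u i else v i) else (if swap then v i else u i)

/-- mass of the pair of intermediate offspring before mutation: with probability 1/2,
two-point crossover with uniform cut positions is applied once to the two parents,
otherwise the two offspring are copies of the two parents -/
def midMass {n : ℕ} (P : Fin 2 → BitString n) (m₀ m₁ : BitString n) : ℝ≥0∞ :=
  (2 : ℝ≥0∞)⁻¹ * (∑ c₁ : Fin (n + 1), ∑ c₂ : Fin (n + 1),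
      (((n : ℝ≥0∞) + 1)⁻¹ * ((n : ℝ≥0∞) + 1)⁻¹) *
        (if m₀ = twoPoint (P 0) (P 1) c₁ c₂ false ∧ m₁ = twoPoint (P 0) (P 1) c₁ c₂ true
          then 1 else 0)) +
  (2 : ℝ≥0∞)⁻¹ * (if m₀ = P 0 ∧ m₁ = P 1 then 1 else 0)

/-- the pairs of positions (among the two parents, indices 0,1, and the two offspring,
indices 2,3) whose pair of search points maximizes the shared population fitness -/
def bestPairs {n : ℕ} (c : Fin 4 → BitString n) : Finset (Fin 4 × Fin 4) :=
  (Finset.univ.filter fun p : Fin 4 × Fin 4 => p.1 < p.2).filter fun p =>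
    ∀ q : Fin 4 × Fin 4, q.1 < q.2 → popFit (c q.1) (c q.2) ≤ popFit (c p.1) (c p.2)

/-- State of a run: the current population of two colorings together with a flag
recording whether a global optimum has been created. -/
abbrev State (n : ℕ) := (Fin 2 → BitString n) × Bool

/-- One generation of the (2+2) GA with fitness sharing: with probability 1/2
two-point crossover is applied once to the two parents to create two offspring
(otherwise the offspring are copies of the parents), standard bit mutation is applied
to both offspring, and among all size-2 sub-multisets of the union of parents and
offspring one maximizing the shared population fitness is selected (uniformly at
random among the maximizers). -/
def trans (n : ℕ) : State n → State n → ℝ≥0∞ := fun s s' =>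
  ∑ m₀ : BitString n, ∑ m₁ : BitString n, midMass s.1 m₀ m₁ *
    ∑ y₀ : BitString n, ∑ y₁ : BitString n, mutProb n m₀ y₀ * mutProb n m₁ y₁ *
      (let c : Fin 4 → BitString n := ![s.1 0, s.1 1, y₀, y₁]
       ∑ p ∈ bestPairs c, ((bestPairs c).card : ℝ≥0∞)⁻¹ *
         (if s'.1 = ![c p.1, c p.2] ∧
             s'.2 = (s.2 || decide (isOpt y₀) || decide (isOpt y₁))
           then 1 else 0))

/-- Initialization: uniform over all populations of two colorings. -/
def init (n : ℕ) : State n → ℝ≥0∞ := fun s =>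
  ((2 : ℝ≥0∞) ^ (n * 2))⁻¹ * (if s.2 = decide (∃ i, isOpt (s.1 i)) then 1 else 0)

/-- expected number of generations until a global optimum is first created -/
def expGens (n : ℕ) : ℝ≥0∞ :=
  ∑' T : ℕ, probOf (evolve (init n) (trans n) T) fun s => ¬ s.2 = true

/-- successor on the ring -/
def nxt {n : ℕ} (i : Fin n) : Fin n := ⟨(i.val + 1) % n, Nat.mod_lt _ i.pos⟩

lemma nxt_val {n : ℕ} (i : Fin n) : (nxt i).val = if i.val + 1 = n then 0 else i.val + 1 := by
  have hi := i.isLt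
  unfold nxt
  split_ifs with h
  · simp [h]
  · exact Nat.mod_eq_of_lt (by omega)

lemma nxt_inj {n : ℕ} : Function.Injective (nxt : Fin n → Fin n) := by
  intro a b h
  have h1 := congrArg Fin.val h
  rw [nxt_val, nxt_val] at h1
  ext
  have := a.isLt
  have := b.isLt
  split_ifs at h1 <;> omega

lemma nxt_bij {n : ℕ} : Function.Bijective (nxt : Fin n → Fin n) :=
  Finite.injective_iff_bijective.mp nxt_inj

lemma nxt_ne {n : ℕ} (hn : 2 ≤ n) (i : Fin n) : nxt i ≠ i := by
  intro h
  have h1 := congrArg Fin.val h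
  rw [nxt_val] at h1
  split_ifs at h1 <;> omega

lemma ring_ind {n : ℕ} (Q : Fin n → Prop) (i₀ : Fin n) (h0 : Q i₀)
    (hs : ∀ i, Q i → Q (nxt i)) (i : Fin n) : Q i := by
  have hk : ∀ k : ℕ, Q ⟨(i₀.val + k) % n, Nat.mod_lt _ i₀.pos⟩ := by
    intro k
    induction k with
    | zero => simpa [Nat.mod_eq_of_lt i₀.isLt] using h0
    | succ k ih =>
      have := hs _ ih
      convert this using 1
      ext
      simp [nxt, ← add_assoc]
  have := hk (n - i₀.val + i.val)
  convert this using 1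
  ext
  have h1 := i₀.isLt
  have h2 : i₀.val + (n - i₀.val + i.val) = i.val + n := by omega
  simp [h2, Nat.mod_eq_of_lt i.isLt]

/-- edge indicator -/
def ed {n : ℕ} (x : BitString n) (j : Fin n) : ℕ := if x j = x (nxt j) then 1 else 0

lemma fit_eq {n : ℕ} (x : BitString n) : isingFit x = ∑ j, ed x j := by
  unfold isingFit ed
  rw [Finset.card_filter]
  rfl

lemma ed_le {n : ℕ} (x : BitString n) (j : Fin n) : ed x j ≤ 1 := by
  unfold ed; split_ifs <;> simp

/-- bichromatic edges -/
def bad {n : ℕ} (x : BitString n) : Finset (Fin n) := Finset.univ.filter fun j => x j ≠ x (nxt j)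

lemma fit_bad {n : ℕ} (x : BitString n) : isingFit x + (bad x).card = n := by
  have := Finset.card_filter_add_card_filter_not (s := (Finset.univ : Finset (Fin n)))
    (p := fun j => x j = x (nxt j))
  simp only [Finset.card_univ, Fintype.card_fin] at this
  exact this

lemma bad_even {n : ℕ} (x : BitString n) : Even (bad x).card := by
  rw [← ZMod.natCast_eq_zero_iff_even]
  unfold bad
  rw [Finset.card_filter]
  push_cast
  let b : Fin n → ZMod 2 := fun j => if x j then 1 else 0
  have h : ∀ j, (if x j ≠ x (nxt j) then (1 : ZMod 2) else 0) = b j + b (nxt j) := by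
    intro j
    simp only [b]
    cases x j <;> cases x (nxt j) <;> simp <;> decide
  rw [Finset.sum_congr rfl (fun j _ => h j), Finset.sum_add_distrib, nxt_bij.sum_comp b]
  exact CharTwo.add_self_eq_zero _

lemma const_opt {n : ℕ} (x : BitString n) (i₀ : Fin n) (h : ∀ i, x i = x i₀) : isOpt x := by
  cases hx : x i₀
  · left; funext i; rw [h i, hx]; rfl
  · right; funext i; rw [h i, hx]; rfl

lemma bad_two {n : ℕ} (hn : 2 ≤ n) (x : BitString n) (hx : ¬ isOpt x) : 2 ≤ (bad x).card := by
  have h1 : (bad x).card ≠ 0 := by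
    intro h0
    rw [Finset.card_eq_zero] at h0
    apply hx
    refine const_opt x ⟨0, by omega⟩ (ring_ind _ ⟨0, by omega⟩ rfl ?_)
    intro i hi
    by_contra hc
    have : i ∈ bad x := by
      simp only [bad, Finset.mem_filter, Finset.mem_univ, true_and]
      intro hh
      exact hc (hh ▸ hi)
    rw [h0] at this
    simp at this
  obtain ⟨k, hk⟩ := bad_even x
  omega

/-- flip a bit -/
def flip {n : ℕ} (x : BitString n) (i : Fin n) : BitString n := Function.update x i (!x i)

lemma flip_same {n : ℕ} (x : BitString n) (i : Fin n) : flip x i i = !x i := by simp [flip]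
lemma flip_ne {n : ℕ} (x : BitString n) {i j : Fin n} (h : j ≠ i) : flip x i j = x j := by
  simp [flip, h]

lemma fit_flip {n : ℕ} (hn : 2 ≤ n) (x : BitString n) (k : Fin n) :
    isingFit (flip x (nxt k)) + 2 * ed x k + 2 * ed x (nxt k) = isingFit x + 2 := by
  have hne : nxt k ≠ k := nxt_ne hn k
  have hsplit : ∀ y : BitString n, isingFit y =
      ed y k + (ed y (nxt k) + ∑ j ∈ (Finset.univ.erase k).erase (nxt k), ed y j) := by
    intro y
    rw [fit_eq, Finset.add_sum_erase _ _ (by simp [hne]), Finset.add_sum_erase _ _ (by simp)]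
  rw [hsplit x, hsplit (flip x (nxt k))]
  have hr : ∑ j ∈ (Finset.univ.erase k).erase (nxt k), ed (flip x (nxt k)) j =
      ∑ j ∈ (Finset.univ.erase k).erase (nxt k), ed x j := by
    apply Finset.sum_congr rfl
    intro j hj
    simp only [Finset.mem_erase, Finset.mem_univ, and_true] at hj
    unfold ed
    rw [flip_ne x hj.1, flip_ne x (fun h => hj.2 (nxt_inj h))]
  have h1 : ed (flip x (nxt k)) k + ed x k = 1 := by
    unfold ed
    rw [flip_same, flip_ne x hne.symm]
    cases x k <;> cases x (nxt k) <;> simp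
  have h2 : ed (flip x (nxt k)) (nxt k) + ed x (nxt k) = 1 := by
    unfold ed
    rw [flip_same, flip_ne x (nxt_ne hn _)]
    cases x (nxt k) <;> cases x (nxt (nxt k)) <;> simp
  rw [hr]
  omega

lemma ham_le {n : ℕ} (x y : BitString n) : hammingDist x y ≤ n := by
  simpa using hammingDist_le_card_fintype (x := x) (y := y)

lemma ham_flip_self {n : ℕ} (x : BitString n) (i : Fin n) : hammingDist x (flip x i) = 1 := by
  unfold hammingDist
  rw [Finset.card_eq_one]
  refine ⟨i, ?_⟩
  ext j
  by_cases h : j = i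
  · subst h; simp [flip_same]
  · simp [flip_ne x h, h]

lemma ham_flip_agree {n : ℕ} (x y : BitString n) (i : Fin n) (h : x i = y i) :
    hammingDist (flip x i) y = hammingDist x y + 1 := by
  unfold hammingDist
  have hni : i ∉ Finset.univ.filter (fun j => x j ≠ y j) := by simp [h]
  rw [← Finset.card_insert_of_notMem hni]
  congr 1
  ext j
  by_cases hj : j = i
  · subst hj; simp [flip_same, h]
  · simp [flip_ne x hj, hj]

lemma popFit_eq {n : ℕ} (hn : 2 ≤ n) (u v : BitString n) :
    popFit u v = ((isingFit u : ℝ) + isingFit v) / (2 - (hammingDist u v : ℝ) / n) := by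
  have hn' : (0 : ℝ) < n := by positivity
  have h1 : (hammingDist u v : ℝ) / n ≤ 1 := by
    rw [div_le_one hn']; exact_mod_cast ham_le u v
  unfold popFit sh
  rw [hammingDist_comm v u, max_eq_right (by linarith : (0:ℝ) ≤ 1 - (hammingDist u v : ℝ) / n)]
  simp only [hammingDist_self, Nat.cast_zero, zero_div, sub_zero]
  rw [max_eq_right (by norm_num : (0:ℝ) ≤ 1), add_div]
  ring_nf

lemma popFit_comm {n : ℕ} (u v : BitString n) : popFit u v = popFit v u := by
  unfold popFit
  rw [add_comm, add_comm (sh v u), add_comm (sh u u)]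

lemma D_bounds {n : ℕ} (hn : 2 ≤ n) (u v : BitString n) :
    1 ≤ 2 - (hammingDist u v : ℝ) / n ∧ 2 - (hammingDist u v : ℝ) / n ≤ 2 := by
  have hn' : (0 : ℝ) < n := by positivity
  have h1 : (hammingDist u v : ℝ) / n ≤ 1 := by
    rw [div_le_one hn']; exact_mod_cast ham_le u v
  have h2 : 0 ≤ (hammingDist u v : ℝ) / n := by positivity
  constructor <;> linarith

lemma popFit_le {n : ℕ} (hn : 2 ≤ n) (u v : BitString n) (hu : ¬ isOpt u) (hv : ¬ isOpt v) :
    popFit u v ≤ 2 * n - 4 := by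
  rw [popFit_eq hn]
  obtain ⟨h1, h2⟩ := D_bounds hn u v
  have a1 := fit_bad u
  have a2 := fit_bad v
  have b1 := bad_two hn u hu
  have b2 := bad_two hn v hv
  have c1 : (isingFit u : ℝ) + 2 ≤ n := by exact_mod_cast (by omega : isingFit u + 2 ≤ n)
  have c2 : (isingFit v : ℝ) + 2 ≤ n := by exact_mod_cast (by omega : isingFit v + 2 ≤ n)
  refine (div_le_self (by positivity) h1).trans (by linarith)

lemma popFit_nonneg {n : ℕ} (u v : BitString n) : 0 ≤ popFit u v := by
  unfold popFit sh
  positivity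

/-- isolated vertex in a string of small fitness -/
lemma exists_isolated {n : ℕ} (x : BitString n) (h : 2 * isingFit x < n) :
    ∃ k, ed x k = 0 ∧ ed x (nxt k) = 0 := by
  by_contra hc
  push Not at hc
  have h1 : ∀ k, 1 ≤ ed x k + ed x (nxt k) := by
    intro k
    by_cases h0 : ed x k = 0
    · have := hc k h0; omega
    · omega
  have h2 : ∑ k : Fin n, 1 ≤ ∑ k, (ed x k + ed x (nxt k)) := Finset.sum_le_sum fun k _ => h1 k
  rw [Finset.sum_add_distrib, nxt_bij.sum_comp (ed x), ← fit_eq] at h2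
  simp at h2
  omega

lemma improve_isolated {n : ℕ} (hn : 2 ≤ n) (u v : BitString n)
    (hu : 2 * isingFit u < n) (hS : 2 * (isingFit u + isingFit v) ≤ n) :
    ∃ i, popFit u v + 1 / 8 ≤ popFit (flip u i) v := by
  obtain ⟨k, h0, h1⟩ := exists_isolated u hu
  refine ⟨nxt k, ?_⟩
  have hf := fit_flip hn u k
  rw [h0, h1] at hf
  have hf' : (isingFit (flip u (nxt k)) : ℝ) = isingFit u + 2 := by
    exact_mod_cast (by omega : isingFit (flip u (nxt k)) = isingFit u + 2)
  rw [popFit_eq hn, popFit_eq hn, hf']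
  obtain ⟨d1, d2⟩ := D_bounds hn u v
  obtain ⟨e1, e2⟩ := D_bounds hn (flip u (nxt k)) v
  have ht : hammingDist u v ≤ 1 + hammingDist (flip u (nxt k)) v := by
    have := hammingDist_triangle u (flip u (nxt k)) v
    rwa [ham_flip_self] at this
  have ht' : (hammingDist u v : ℝ) ≤ 1 + hammingDist (flip u (nxt k)) v := by exact_mod_cast ht
  have hn' : (2 : ℝ) ≤ n := by exact_mod_cast hn
  have hS' : 2 * ((isingFit u : ℝ) + isingFit v) ≤ n := by exact_mod_cast hS
  have hd : 2 - (hammingDist (flip u (nxt k)) v : ℝ) / n ≤ (2 - (hammingDist u v : ℝ) / n) + 1 / n := by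
    have : (hammingDist u v : ℝ) / n ≤ (1 + hammingDist (flip u (nxt k)) v) / n := by gcongr
    rw [add_div] at this
    linarith
  set D := 2 - (hammingDist u v : ℝ) / n
  set D' := 2 - (hammingDist (flip u (nxt k)) v : ℝ) / n
  have hS0 : 0 ≤ (isingFit u : ℝ) + isingFit v := by positivity
  rw [show (isingFit u : ℝ) + 2 + isingFit v = (isingFit u + isingFit v) + 2 by ring]
  set S := (isingFit u : ℝ) + isingFit v
  have hSn : S * (D' - D) ≤ 1 / 2 := by
    have h3 : S * (D' - D) ≤ S * (1 / n) := by
      apply mul_le_mul_of_nonneg_left _ hS0; linarith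
    have h4 : S * (1 / n) ≤ 1 / 2 := by
      rw [mul_one_div, div_le_iff₀ (by linarith)]; linarith
    linarith
  rw [div_add' _ _ _ (by linarith), div_le_div_iff₀ (by linarith) (by linarith)]
  nlinarith [mul_nonneg (sub_nonneg.2 d1) (sub_nonneg.2 e1), mul_nonneg (sub_nonneg.2 d2) (sub_nonneg.2 e2), mul_nonneg (sub_nonneg.2 d1) (sub_nonneg.2 e2)]

lemma improve_agree {n : ℕ} (hn : 2 ≤ n) (u v : BitString n) (i : Fin n) (ha : u i = v i)
    (hb : u i ≠ u (nxt i)) (hS : n ≤ 2 * (isingFit u + isingFit v)) :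
    popFit u v + 1 / 8 ≤ popFit (flip u i) v := by
  obtain ⟨k, rfl⟩ := nxt_bij.surjective i
  have hf := fit_flip hn u k
  have h0 : ed u (nxt k) = 0 := by simp [ed, hb]
  have h1 := ed_le u k
  have hf' : (isingFit u : ℝ) ≤ isingFit (flip u (nxt k)) := by
    exact_mod_cast (by omega : isingFit u ≤ isingFit (flip u (nxt k)))
  rw [popFit_eq hn, popFit_eq hn]
  obtain ⟨d1, d2⟩ := D_bounds hn u v
  obtain ⟨e1, e2⟩ := D_bounds hn (flip u (nxt k)) v
  have hn' : (2 : ℝ) ≤ n := by exact_mod_cast hn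
  have hS' : (n : ℝ) ≤ 2 * ((isingFit u : ℝ) + isingFit v) := by exact_mod_cast hS
  have hd : 2 - (hammingDist (flip u (nxt k)) v : ℝ) / n = (2 - (hammingDist u v : ℝ) / n) - 1 / n := by
    rw [ham_flip_agree u v _ ha]; push_cast; ring
  set D := 2 - (hammingDist u v : ℝ) / n
  set D' := 2 - (hammingDist (flip u (nxt k)) v : ℝ) / n
  have hS0 : 0 ≤ (isingFit u : ℝ) + isingFit v := by positivity
  have hle : ((isingFit u : ℝ) + isingFit v) / D' ≤ ((isingFit (flip u (nxt k)) : ℝ) + isingFit v) / D' := by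
    gcongr
  refine le_trans ?_ hle
  set S := (isingFit u : ℝ) + isingFit v
  have hSn : 1 / 2 ≤ S * (D - D') := by
    have h3 : D - D' = 1 / n := by linarith
    rw [h3, mul_one_div, le_div_iff₀ (by linarith)]; linarith
  rw [div_add' _ _ _ (by linarith), div_le_div_iff₀ (by linarith) (by linarith)]
  nlinarith [mul_nonneg (sub_nonneg.2 d2) (sub_nonneg.2 e2), mul_nonneg (sub_nonneg.2 d1) (sub_nonneg.2 e2)]

lemma caseA {n : ℕ} (hn : 2 ≤ n) (u v : BitString n) (hu : ¬ isOpt u)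
    (h : ∃ i, u i = v i) :
    ∃ i, popFit u v + 1 / 8 ≤ popFit (flip u i) v ∨ popFit u v + 1 / 8 ≤ popFit u (flip v i) := by
  by_cases hS : 2 * (isingFit u + isingFit v) < n
  · by_cases h1 : 2 * isingFit u < n
    · obtain ⟨i, hi⟩ := improve_isolated hn u v h1 hS.le
      exact ⟨i, Or.inl hi⟩
    · omega
  · push Not at hS
    by_contra hc
    push Not at hc
    obtain ⟨i₀, hi₀⟩ := h
    have key : ∀ i, u i = v i → u (nxt i) = u i ∧ v (nxt i) = v i := by
      intro i hi
      constructor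
      · by_contra hb
        exact absurd (improve_agree hn u v i hi (Ne.symm hb) hS) (not_le.2 (hc i).1)
      · by_contra hb
        have := improve_agree hn v u i hi.symm (Ne.symm hb) (by omega)
        rw [popFit_comm v u, popFit_comm _ u] at this
        exact absurd this (not_le.2 (hc i).2)
    have := ring_ind (fun i => u i = u i₀ ∧ v i = u i₀) i₀ ⟨rfl, hi₀.symm⟩ (by
      rintro i ⟨a, b⟩
      obtain ⟨c, d⟩ := key i (a.trans b.symm)
      exact ⟨c.trans a, d.trans b⟩)
    exact hu (const_opt u i₀ fun i => (this i).1)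

/-- cut position right of vertex j -/
def cut {n : ℕ} (j : Fin n) : Fin (n + 1) := j.succ

lemma cross_iff {n : ℕ} (j₁ j₂ : Fin n) (h : j₁ ≠ j₂) (j : Fin n) :
    ((min (cut j₁).val (cut j₂).val ≤ j.val ∧ j.val < max (cut j₁).val (cut j₂).val) ↔
      (min (cut j₁).val (cut j₂).val ≤ (nxt j).val ∧ (nxt j).val < max (cut j₁).val (cut j₂).val))
      ↔ (j ≠ j₁ ∧ j ≠ j₂) := by
  have h' : j₁.val ≠ j₂.val := fun hh => h (Fin.ext hh)
  have e1 : (cut j₁).val = j₁.val + 1 := by simp [cut]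
  have e2 : (cut j₂).val = j₂.val + 1 := by simp [cut]
  have := j.isLt
  have := j₁.isLt
  have := j₂.isLt
  rw [e1, e2, nxt_val, Ne, Ne, Fin.ext_iff, Fin.ext_iff]
  split_ifs <;> omega

lemma fit_not {n : ℕ} (u : BitString n) : isingFit (fun i => !u i) = isingFit u := by
  rw [fit_eq, fit_eq]
  apply Finset.sum_congr rfl
  intro j _
  unfold ed
  simp

lemma cross_fit {n : ℕ} (u : BitString n) (j₁ j₂ : Fin n) (h : j₁ ≠ j₂)
    (h1 : j₁ ∈ bad u) (h2 : j₂ ∈ bad u) :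
    isingFit (twoPoint u (fun i => !u i) (cut j₁) (cut j₂) false) = isingFit u + 2 := by
  set y := twoPoint u (fun i => !u i) (cut j₁) (cut j₂) false with hy
  have hbad : bad u = insert j₁ (insert j₂ (bad y)) := by
    ext j
    have hc := cross_iff j₁ j₂ h j
    simp only [bad, Finset.mem_filter, Finset.mem_univ, true_and] at h1 h2
    simp only [bad, Finset.mem_insert, Finset.mem_filter, Finset.mem_univ, true_and, hy, twoPoint]
    by_cases ha : j = j₁
    · subst ha; simp [h1]
    by_cases hb : j = j₂
    · subst hb; simp [h2]
    have hc' := hc.2 ⟨ha, hb⟩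
    simp only [ha, hb, false_or, hc']
    split_ifs <;> simp_all
  have hj1 : j₁ ∉ bad y := by
    have hc := cross_iff j₁ j₂ h j₁
    simp only [bad, Finset.mem_filter, Finset.mem_univ, true_and, hy, twoPoint] at h1 ⊢
    simp only [ne_eq, not_true_eq_false, false_and, iff_false] at hc
    revert h1
    split_ifs <;> first | (exfalso; tauto) | (cases u j₁ <;> cases u (nxt j₁) <;> simp)
  have hj2 : j₂ ∉ bad y := by
    have hc := cross_iff j₁ j₂ h j₂
    simp only [bad, Finset.mem_filter, Finset.mem_univ, true_and, hy, twoPoint] at h2 ⊢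
    simp only [ne_eq, not_true_eq_false, and_false, iff_false] at hc
    revert h2
    split_ifs <;> first | (exfalso; tauto) | (cases u j₂ <;> cases u (nxt j₂) <;> simp)
  have c : (bad u).card = (bad y).card + 2 := by
    rw [hbad, Finset.card_insert_of_notMem (by simp [h, hj1]), Finset.card_insert_of_notMem hj2]
  have := fit_bad u
  have := fit_bad y
  omega

lemma ham_not {n : ℕ} (u : BitString n) : hammingDist u (fun i => !u i) = n := by
  unfold hammingDist
  simp

lemma popFit_not {n : ℕ} (hn : 2 ≤ n) (u : BitString n) :
    popFit u (fun i => !u i) = 2 * isingFit u := by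
  have : (n : ℝ) ≠ 0 := by positivity
  rw [popFit_eq hn, ham_not, fit_not, div_self this]
  ring

lemma cross_pop {n : ℕ} (hn : 2 ≤ n) (u : BitString n) (j₁ j₂ : Fin n) (h : j₁ ≠ j₂)
    (h1 : j₁ ∈ bad u) (h2 : j₂ ∈ bad u) :
    popFit (twoPoint u (fun i => !u i) (cut j₁) (cut j₂) false)
      (twoPoint u (fun i => !u i) (cut j₁) (cut j₂) true) = popFit u (fun i => !u i) + 4 := by
  have e : twoPoint u (fun i => !u i) (cut j₁) (cut j₂) true =
      fun i => !(twoPoint u (fun i => !u i) (cut j₁) (cut j₂) false i) := by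
    funext i
    simp only [twoPoint]
    split_ifs <;> simp_all
  rw [e, popFit_not hn, popFit_not hn, cross_fit u j₁ j₂ h h1 h2]
  push_cast
  ring

lemma lyapunov {S : Type*} [Fintype S] (ini : S → ℝ≥0∞) (tr : S → S → ℝ≥0∞) (A : S → Prop)
    (g : S → ℝ≥0∞) (h : ∀ s, ∑ s', tr s s' * g s' + (if A s then 1 else 0) ≤ g s) :
    ∑' T : ℕ, probOf (evolve ini tr T) A ≤ ∑ s, ini s * g s := by
  have key : ∀ N : ℕ, ∑ T ∈ Finset.range N, probOf (evolve ini tr T) A +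
      ∑ s, evolve ini tr N s * g s ≤ ∑ s, ini s * g s := by
    intro N
    induction N with
    | zero => simp [evolve]
    | succ N ih =>
      refine le_trans ?_ ih
      rw [Finset.sum_range_succ, add_assoc]
      refine add_le_add le_rfl ?_
      have e1 : ∑ s', evolve ini tr (N + 1) s' * g s' =
          ∑ s, evolve ini tr N s * ∑ s', tr s s' * g s' := by
        simp only [evolve, Finset.sum_mul, Finset.mul_sum]
        rw [Finset.sum_comm]
        refine Finset.sum_congr rfl fun s _ => Finset.sum_congr rfl fun s' _ => ?_
        ring
      rw [e1]
      unfold probOf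
      rw [← Finset.sum_add_distrib]
      refine Finset.sum_le_sum fun s _ => ?_
      refine le_trans (le_of_eq ?_) (mul_le_mul_right (h s) (evolve ini tr N s))
      split_ifs <;> ring
  refine ENNReal.tsum_le_of_sum_range_le fun N => ?_
  exact le_trans le_self_add (key N)

/-- potential as a function of the gap -/
def gam (n : ℕ) (x : ℝ) : ℝ := 256 * n * x + 256 * (n : ℝ) ^ 2 * (1 - 1 / x)

/-- potential -/
def pot (n : ℕ) (s : State n) : ℝ≥0∞ :=
  if s.2 = true then 0 else if ∃ i, isOpt (s.1 i) then ⊤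
  else ENNReal.ofReal (gam n (2 * n - popFit (s.1 0) (s.1 1)))

/-- expected potential after selection -/
def selPot {n : ℕ} (s : State n) (y₀ y₁ : BitString n) : ℝ≥0∞ :=
  ∑ p ∈ bestPairs (![s.1 0, s.1 1, y₀, y₁] : Fin 4 → BitString n),
    ((bestPairs (![s.1 0, s.1 1, y₀, y₁] : Fin 4 → BitString n)).card : ℝ≥0∞)⁻¹ *
      pot n (![(![s.1 0, s.1 1, y₀, y₁] : Fin 4 → BitString n) p.1,
        (![s.1 0, s.1 1, y₀, y₁] : Fin 4 → BitString n) p.2],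
        (s.2 || decide (isOpt y₀) || decide (isOpt y₁)))

/-- expected potential after mutation and selection -/
def mutPot {n : ℕ} (s : State n) (m₀ m₁ : BitString n) : ℝ≥0∞ :=
  ∑ y₀ : BitString n, ∑ y₁ : BitString n, mutProb n m₀ y₀ * mutProb n m₁ y₁ * selPot s y₀ y₁

lemma trans_pot {n : ℕ} (s : State n) : ∑ s', trans n s s' * pot n s' =
    ∑ m₀ : BitString n, ∑ m₁ : BitString n, midMass s.1 m₀ m₁ * mutPot s m₀ m₁ := by
  unfold trans mutPot selPot
  simp only [Finset.sum_mul]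
  rw [Finset.sum_comm]
  refine Finset.sum_congr rfl fun m₀ _ => ?_
  rw [Finset.sum_comm]
  refine Finset.sum_congr rfl fun m₁ _ => ?_
  simp only [mul_assoc]
  rw [← Finset.mul_sum]
  congr 1
  simp only [Finset.sum_mul]
  rw [Finset.sum_comm]
  refine Finset.sum_congr rfl fun y₀ _ => ?_
  rw [Finset.sum_comm]
  refine Finset.sum_congr rfl fun y₁ _ => ?_
  simp only [mul_assoc]
  rw [← Finset.mul_sum, ← Finset.mul_sum]
  congr 2
  simp only [Finset.sum_mul]
  rw [Finset.sum_comm]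
  refine Finset.sum_congr rfl fun p _ => ?_
  simp only [mul_assoc]
  rw [← Finset.mul_sum]
  congr 1
  simp only [ite_mul, one_mul, zero_mul, ← Prod.ext_iff (y := (_, _))]
  rw [Finset.sum_eq_single (![(![s.1 0, s.1 1, y₀, y₁] : Fin 4 → BitString n) p.1,
        (![s.1 0, s.1 1, y₀, y₁] : Fin 4 → BitString n) p.2],
        (s.2 || decide (isOpt y₀) || decide (isOpt y₁)))]
  · simp
  · intro b _ hb
    rw [if_neg]
    intro hc
    exact hb hc
  · simp

lemma mid_sum {n : ℕ} (P : Fin 2 → BitString n) (K : BitString n → BitString n → ℝ≥0∞) :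
    ∑ m₀ : BitString n, ∑ m₁ : BitString n, midMass P m₀ m₁ * K m₀ m₁ =
    (2 : ℝ≥0∞)⁻¹ * (∑ c₁ : Fin (n + 1), ∑ c₂ : Fin (n + 1),
      (((n : ℝ≥0∞) + 1)⁻¹ * ((n : ℝ≥0∞) + 1)⁻¹) *
        K (twoPoint (P 0) (P 1) c₁ c₂ false) (twoPoint (P 0) (P 1) c₁ c₂ true)) +
    (2 : ℝ≥0∞)⁻¹ * K (P 0) (P 1) := by
  have one : ∀ a b : BitString n, ∑ m₀ : BitString n, ∑ m₁ : BitString n,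
      (if m₀ = a ∧ m₁ = b then (1 : ℝ≥0∞) else 0) * K m₀ m₁ = K a b := by
    intro a b
    rw [Finset.sum_eq_single a, Finset.sum_eq_single b]
    · simp
    · intro m _ hm; simp [hm]
    · simp
    · intro m _ hm; simp [hm]
    · simp
  unfold midMass
  simp only [add_mul, Finset.sum_add_distrib]
  congr 1
  · simp only [mul_assoc, ← Finset.mul_sum, Finset.sum_mul]
    congr 1
    simp only [← mul_assoc]
    simp only [Finset.mul_sum, mul_assoc]
    have e : ∀ (f : BitString n → Fin (n+1) → Fin (n+1) → ℝ≥0∞),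
        ∑ m₁ : BitString n, ∑ c₁, ∑ c₂, f m₁ c₁ c₂ = ∑ c₁, ∑ c₂, ∑ m₁ : BitString n, f m₁ c₁ c₂ := by
      intro f
      rw [Finset.sum_comm]
      exact Finset.sum_congr rfl fun c₁ _ => Finset.sum_comm
    rw [Finset.sum_congr rfl fun m₀ _ => e _, e]
    refine Finset.sum_congr rfl fun c₁ _ => Finset.sum_congr rfl fun c₂ _ => ?_
    simp only [← Finset.mul_sum]
    rw [one]
  · simp only [mul_assoc, ← Finset.mul_sum]
    rw [one]

lemma mut_prod {n : ℕ} (x y : BitString n) :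
    mutProb n x y = ∏ i, if x i ≠ y i then (n : ℝ≥0∞)⁻¹ else 1 - (n : ℝ≥0∞)⁻¹ := by
  unfold mutProb
  rw [Finset.prod_ite, Finset.prod_const, Finset.prod_const]
  have h := Finset.card_filter_add_card_filter_not (s := (Finset.univ : Finset (Fin n)))
    (p := fun j => x j ≠ y j)
  simp only [Finset.card_univ, Fintype.card_fin] at h
  have e : hammingDist x y = (Finset.univ.filter fun j => x j ≠ y j).card := by
    unfold hammingDist; congr
  rw [e]
  congr 2
  omega

lemma mut_sum {n : ℕ} (hn : 2 ≤ n) (x : BitString n) : ∑ y, mutProb n x y = 1 := by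
  simp only [mut_prod]
  rw [← Fintype.piFinset_univ, ← Finset.prod_univ_sum (fun _ => (Finset.univ : Finset Bool))
    (fun i b => if x i ≠ b then (n : ℝ≥0∞)⁻¹ else 1 - (n : ℝ≥0∞)⁻¹)]
  apply Finset.prod_eq_one
  intro i _
  have h1 : (n : ℝ≥0∞)⁻¹ ≤ 1 := by
    rw [ENNReal.inv_le_one]; exact_mod_cast (by omega : 1 ≤ n)
  rw [Fintype.sum_bool]
  cases x i
  · simpa using add_tsub_cancel_of_le h1
  · simpa using tsub_add_cancel_of_le h1

lemma pow_quarter {n : ℕ} (hn : 2 ≤ n) (he : Even n) :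
    ENNReal.ofReal (1 / 4) ≤ (1 - (n : ℝ≥0∞)⁻¹) ^ n := by
  have hn' : (0 : ℝ) < n := by positivity
  have h2 : (2 : ℝ) ≤ n := by exact_mod_cast hn
  have e : (1 - (n : ℝ≥0∞)⁻¹) = ENNReal.ofReal (1 - 1 / n) := by
    rw [ENNReal.ofReal_sub _ (by positivity), ENNReal.ofReal_one, ENNReal.ofReal_div_of_pos hn']
    simp
  have hi : (1 : ℝ) / n ≤ 1 / 2 := by
    apply one_div_le_one_div_of_le <;> linarith
  rw [e, ← ENNReal.ofReal_pow (by linarith)]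
  apply ENNReal.ofReal_le_ofReal
  obtain ⟨k, hk⟩ := he
  have hb := one_add_mul_le_pow (a := -(1 / (n : ℝ))) (by linarith) k
  have hk' : (n : ℝ) = k + k := by exact_mod_cast hk
  have hkn : (k : ℝ) * (1 / n) = 1 / 2 := by
    rw [mul_one_div, div_eq_iff hn'.ne']; linarith
  have hb' : 1 / 2 ≤ (1 - 1 / (n : ℝ)) ^ k := by
    rw [← sub_eq_add_neg] at hb; linarith
  calc (1 : ℝ) / 4 = (1/2) * (1/2) := by norm_num
    _ ≤ (1 - 1 / (n : ℝ)) ^ k * (1 - 1 / (n : ℝ)) ^ k := by gcongr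
    _ = _ := by rw [← pow_add, ← hk]

lemma mut_self {n : ℕ} (hn : 2 ≤ n) (he : Even n) (x : BitString n) :
    ENNReal.ofReal (1 / 4) ≤ mutProb n x x := by
  unfold mutProb
  simpa using pow_quarter hn he

lemma mut_flip {n : ℕ} (hn : 2 ≤ n) (he : Even n) (x : BitString n) (i : Fin n) :
    ENNReal.ofReal (1 / (4 * n)) ≤ mutProb n x (flip x i) := by
  unfold mutProb
  rw [ham_flip_self, pow_one]
  have hn' : (0 : ℝ) < n := by positivity
  have e : ENNReal.ofReal (1 / (4 * n)) = (n : ℝ≥0∞)⁻¹ * ENNReal.ofReal (1 / 4) := by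
    rw [show (1 : ℝ) / (4 * n) = (n : ℝ)⁻¹ * (1 / 4) by field_simp,
      ENNReal.ofReal_mul (by positivity), ENNReal.ofReal_inv_of_pos hn', ENNReal.ofReal_natCast]
  rw [e]
  gcongr
  refine (pow_quarter hn he).trans ?_
  exact pow_le_pow_right_of_le_one' (by simp) (by omega)

lemma sel_le {n : ℕ} (s : State n) (y₀ y₁ : BitString n) (M : ℝ≥0∞)
    (h : ∀ p ∈ bestPairs (![s.1 0, s.1 1, y₀, y₁] : Fin 4 → BitString n),
      pot n (![(![s.1 0, s.1 1, y₀, y₁] : Fin 4 → BitString n) p.1,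
        (![s.1 0, s.1 1, y₀, y₁] : Fin 4 → BitString n) p.2],
        (s.2 || decide (isOpt y₀) || decide (isOpt y₁))) ≤ M) : selPot s y₀ y₁ ≤ M := by
  unfold selPot
  refine (Finset.sum_le_sum fun p hp => mul_le_mul_right (h p hp) _).trans ?_
  rw [Finset.sum_const, nsmul_eq_mul, ← mul_assoc]
  exact mul_le_of_le_one_left (zero_le) (ENNReal.mul_inv_le_one _)

/-- the selection lemma -/
lemma sel_bound {n : ℕ} (hn : 2 ≤ n) (s : State n) (hf : s.2 = false)
    (h0 : ∀ i, ¬ isOpt (s.1 i)) (y₀ y₁ : BitString n) (q : Fin 4 × Fin 4) (hq : q.1 < q.2)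
    (M : ℝ)
    (hM : ∀ x, 4 ≤ x → x ≤ 2 * n - popFit ((![s.1 0, s.1 1, y₀, y₁] : Fin 4 → BitString n) q.1)
      ((![s.1 0, s.1 1, y₀, y₁] : Fin 4 → BitString n) q.2) → gam n x ≤ M) :
    selPot s y₀ y₁ ≤ ENNReal.ofReal M := by
  apply sel_le
  intro p hp
  simp only [bestPairs, Finset.mem_filter, Finset.mem_univ, true_and] at hp
  obtain ⟨_, hp⟩ := hp
  have hpq := hp q hq
  unfold pot
  by_cases ha : isOpt y₀
  · simp [ha]
  by_cases hb : isOpt y₁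
  · simp [hb]
  have hc : ∀ r : Fin 4, ¬ isOpt ((![s.1 0, s.1 1, y₀, y₁] : Fin 4 → BitString n) r) := by
    intro r
    fin_cases r
    · exact h0 0
    · exact h0 1
    · exact ha
    · exact hb
  rw [if_neg (by simp [hf, ha, hb]), if_neg (by
    rintro ⟨i, hi⟩
    fin_cases i
    · exact hc _ hi
    · exact hc _ hi)]
  apply ENNReal.ofReal_le_ofReal
  apply hM
  · have := popFit_le hn _ _ (hc p.1) (hc p.2)
    simp only [Matrix.cons_val_zero, Matrix.cons_val_one]
    linarith
  · simp only [Matrix.cons_val_zero, Matrix.cons_val_one]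
    linarith

lemma gam_mono {n : ℕ} {x y : ℝ} (hx : 4 ≤ x) (h : x ≤ y) : gam n x + 256 * n * (y - x) ≤ gam n y := by
  unfold gam
  have : 1 / y ≤ 1 / x := one_div_le_one_div_of_le (by linarith) h
  have : 256 * (n : ℝ) ^ 2 * (1 - 1 / x) ≤ 256 * (n : ℝ) ^ 2 * (1 - 1 / y) := by gcongr
  linarith

lemma gam_nonneg {n : ℕ} {x : ℝ} (hx : 4 ≤ x) : 256 * n * x + 192 * (n : ℝ) ^ 2 ≤ gam n x := by
  unfold gam
  have : 1 / x ≤ 1 / 4 := one_div_le_one_div_of_le (by norm_num) hx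
  have : 256 * (n : ℝ) ^ 2 * (1 - 1 / 4) ≤ 256 * (n : ℝ) ^ 2 * (1 - 1 / x) := by gcongr
  linarith

lemma gam_drop {n : ℕ} {x y : ℝ} (hx : 4 ≤ x) (h : x + 4 ≤ y) :
    gam n x + 1024 * n ^ 2 / y ^ 2 ≤ gam n y := by
  have hxy : 4 / y ^ 2 ≤ 1 / x - 1 / y := by
    rw [div_sub_div _ _ (by linarith) (by linarith), div_le_div_iff₀ (by nlinarith) (by nlinarith)]
    have : 0 ≤ y * y * (y - x - 4) + 4 * y * (y - x) := by
      have h1 : 0 ≤ y * y * (y - x - 4) := mul_nonneg (by nlinarith) (by linarith)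
      have h2 : 0 ≤ 4 * y * (y - x) := mul_nonneg (by linarith) (by linarith)
      linarith
    nlinarith
  unfold gam
  have h1 : 256 * (n : ℝ) ^ 2 * (4 / y ^ 2) ≤ 256 * (n : ℝ) ^ 2 * (1 / x - 1 / y) := by gcongr
  have h2 : 256 * (n : ℝ) * x ≤ 256 * n * y := by gcongr; linarith
  have h3 : 256 * (n : ℝ) ^ 2 * (4 / y ^ 2) = 1024 * n ^ 2 / y ^ 2 := by ring
  linarith

lemma mutPot_le {n : ℕ} (hn : 2 ≤ n) (s : State n) (M : ℝ≥0∞) (h : ∀ y₀ y₁, selPot s y₀ y₁ ≤ M)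
    (m₀ m₁ z₀ z₁ : BitString n) (Δ : ℝ≥0∞) (hz : selPot s z₀ z₁ + Δ ≤ M) :
    mutPot s m₀ m₁ + mutProb n m₀ z₀ * mutProb n m₁ z₁ * Δ ≤ M := by
  have e : mutProb n m₀ z₀ * mutProb n m₁ z₁ * Δ = ∑ y₀ : BitString n, ∑ y₁ : BitString n,
      mutProb n m₀ y₀ * mutProb n m₁ y₁ * (if y₀ = z₀ ∧ y₁ = z₁ then Δ else 0) := by
    rw [Finset.sum_eq_single z₀, Finset.sum_eq_single z₁]
    · simp
    · intro m _ hm; simp [hm]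
    · simp
    · intro m _ hm; simp [hm]
    · simp
  unfold mutPot
  rw [e, ← Finset.sum_add_distrib]
  simp only [← Finset.sum_add_distrib, ← mul_add]
  calc _ ≤ ∑ y₀ : BitString n, ∑ y₁ : BitString n, mutProb n m₀ y₀ * mutProb n m₁ y₁ * M := by
        refine Finset.sum_le_sum fun y₀ _ => Finset.sum_le_sum fun y₁ _ => ?_
        refine mul_le_mul_right ?_ _
        split_ifs with hc
        · obtain ⟨rfl, rfl⟩ := hc; exact hz
        · simpa using h y₀ y₁
    _ = M := by
        simp only [mul_assoc, ← Finset.mul_sum, ← Finset.sum_mul, mut_sum hn, one_mul]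

lemma mid_total (n : ℕ) (M : ℝ≥0∞) : (2 : ℝ≥0∞)⁻¹ * (∑ _c₁ : Fin (n + 1), ∑ _c₂ : Fin (n + 1),
      (((n : ℝ≥0∞) + 1)⁻¹ * ((n : ℝ≥0∞) + 1)⁻¹) * M) + (2 : ℝ≥0∞)⁻¹ * M = M := by
  have h0 : ((n : ℝ≥0∞) + 1) * ((n : ℝ≥0∞) + 1)⁻¹ = 1 :=
    ENNReal.mul_inv_cancel (by simp) (by simp)
  have : (∑ _c₁ : Fin (n + 1), ∑ _c₂ : Fin (n + 1),
      (((n : ℝ≥0∞) + 1)⁻¹ * ((n : ℝ≥0∞) + 1)⁻¹) * M) = M := by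
    simp only [Finset.sum_const, Finset.card_univ, Fintype.card_fin, nsmul_eq_mul]
    push_cast
    calc _ = (((n : ℝ≥0∞) + 1) * ((n : ℝ≥0∞) + 1)⁻¹) * (((n : ℝ≥0∞) + 1) * ((n : ℝ≥0∞) + 1)⁻¹) * M := by ring
      _ = M := by rw [h0]; simp
  rw [this, ← add_mul, ENNReal.inv_two_add_inv_two, one_mul]

lemma drift {n : ℕ} (hn : 2 ≤ n) (he : Even n) (s : State n) :
    ∑ s', trans n s s' * pot n s' + (if ¬ s.2 = true then 1 else 0) ≤ pot n s := by
  by_cases hf : s.2 = true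
  · have h0 : ∀ y₀ y₁, selPot s y₀ y₁ = 0 := by
      intro y₀ y₁
      apply le_antisymm _ (zero_le)
      apply sel_le
      intro p _
      simp [pot, hf]
    rw [trans_pot]
    simp [mutPot, h0, hf]
  by_cases ho : ∃ i, isOpt (s.1 i)
  · have : pot n s = ⊤ := by simp only [pot, if_neg hf, if_pos ho]
    rw [this]; exact le_top
  have hf' : s.2 = false := by simpa using hf
  have hn' : (2 : ℝ) ≤ n := by exact_mod_cast hn
  have ho' : ∀ i, ¬ isOpt (s.1 i) := fun i hi => ho ⟨i, hi⟩
  have hp : pot n s = ENNReal.ofReal (gam n (2 * n - popFit (s.1 0) (s.1 1))) := by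
    simp only [pot, if_neg hf, if_neg ho]
  have hx4 : 4 ≤ 2 * n - popFit (s.1 0) (s.1 1) := by
    have := popFit_le hn _ _ (ho' 0) (ho' 1)
    linarith
  have hall : ∀ y₀ y₁, selPot s y₀ y₁ ≤ pot n s := by
    intro y₀ y₁
    rw [hp]
    refine sel_bound hn s hf' ho' y₀ y₁ (0, 1) (by decide) _ ?_
    intro x h4 hx
    have hx' : x ≤ 2 * n - popFit (s.1 0) (s.1 1) := hx
    have := gam_mono (n := n) h4 hx'
    have h5 : 0 ≤ 256 * (n : ℝ) * (2 * n - popFit (s.1 0) (s.1 1) - x) :=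
      mul_nonneg (by positivity) (by linarith)
    linarith
  have hall' : ∀ m₀ m₁, mutPot s m₀ m₁ ≤ pot n s := by
    intro m₀ m₁
    have := mutPot_le hn s _ hall m₀ m₁ m₀ m₁ 0 (by simpa using hall m₀ m₁)
    simpa using this
  -- a pair of offspring that improves the population
  have hgood : ∀ z₀ z₁ : BitString n, ∀ Δ : ℝ, 0 ≤ Δ →
      Δ ≤ gam n (2 * n - popFit (s.1 0) (s.1 1)) →
      (∀ x, 4 ≤ x → x ≤ 2 * n - popFit z₀ z₁ →
        gam n x + Δ ≤ gam n (2 * n - popFit (s.1 0) (s.1 1))) →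
      selPot s z₀ z₁ + ENNReal.ofReal Δ ≤ pot n s := by
    intro z₀ z₁ Δ h0 h1 h2
    have := sel_bound hn s hf' ho' z₀ z₁ (2, 3) (by decide)
      (gam n (2 * n - popFit (s.1 0) (s.1 1)) - Δ) (by
        intro x h4 hx
        have := h2 x h4 hx
        linarith)
    refine (add_le_add this le_rfl).trans ?_
    rw [← ENNReal.ofReal_add (by linarith) h0, hp]
    apply le_of_eq
    congr 1
    ring
  rw [if_pos hf, trans_pot, mid_sum]
  refine le_trans ?_ (mid_total n (pot n s)).le
  by_cases hA : ∃ i, s.1 0 i = s.1 1 i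
  · have hz : ∃ z₀ z₁ : BitString n, popFit (s.1 0) (s.1 1) + 1 / 8 ≤ popFit z₀ z₁ ∧
        ENNReal.ofReal (1 / (16 * n)) ≤ mutProb n (s.1 0) z₀ * mutProb n (s.1 1) z₁ := by
      have e : ENNReal.ofReal (1 / (16 * n)) = ENNReal.ofReal (1 / (4 * n)) * ENNReal.ofReal (1 / 4) := by
        rw [← ENNReal.ofReal_mul (by positivity)]
        congr 1
        field_simp
        norm_num
      rw [e]
      obtain ⟨i, hi | hi⟩ := caseA hn _ _ (ho' 0) hA
      · exact ⟨_, _, hi, mul_le_mul' (mut_flip hn he _ i) (mut_self hn he _)⟩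
      · refine ⟨_, _, hi, ?_⟩
        rw [mul_comm]
        exact mul_le_mul' (mut_self hn he _) (mut_flip hn he _ i)
    obtain ⟨z₀, z₁, hz1, hz2⟩ := hz
    have h1 := hgood z₀ z₁ (32 * n) (by positivity) (by
        have := gam_nonneg (n := n) hx4
        nlinarith) (by
        intro x h4 hx
        have hx2 : x + 1 / 8 ≤ 2 * n - popFit (s.1 0) (s.1 1) := by linarith
        have := gam_mono (n := n) h4 (by linarith : x ≤ 2 * n - popFit (s.1 0) (s.1 1))
        nlinarith)
    have h2 := mutPot_le hn s _ hall (s.1 0) (s.1 1) z₀ z₁ _ h1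
    have h3 : (2 : ℝ≥0∞) ≤ mutProb n (s.1 0) z₀ * mutProb n (s.1 1) z₁ * ENNReal.ofReal (32 * n) := by
      refine le_trans (le_of_eq ?_) (mul_le_mul_left hz2 _)
      rw [← ENNReal.ofReal_mul (by positivity)]
      rw [show 1 / (16 * (n : ℝ)) * (32 * n) = 2 by field_simp; norm_num]
      simp
    have h4 : mutPot s (s.1 0) (s.1 1) + 2 ≤ pot n s := (add_le_add le_rfl h3).trans h2
    rw [add_assoc]
    refine add_le_add ?_ ?_
    · refine mul_le_mul_right ?_ _
      refine Finset.sum_le_sum fun c₁ _ => Finset.sum_le_sum fun c₂ _ => ?_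
      exact mul_le_mul_right (hall' _ _) _
    · refine le_trans (le_of_eq ?_) (mul_le_mul_right h4 _)
      rw [mul_add, ENNReal.inv_mul_cancel (by simp) (by simp)]
  · -- complementary parents
    push Not at hA
    obtain ⟨u, hu⟩ : ∃ u, u = s.1 0 := ⟨_, rfl⟩
    have hv : s.1 1 = fun i => !u i := by
      funext i
      have := hA i
      rw [hu]
      revert this
      cases s.1 0 i <;> cases s.1 1 i <;> simp
    rw [← hu, hv] at hgood hp hx4 ⊢
    have hi2 : 2 ≤ (bad u).card := bad_two hn u (hu ▸ ho' 0)
    have hfb := fit_bad u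
    obtain ⟨i, hi⟩ : ∃ i, i = (bad u).card := ⟨_, rfl⟩
    rw [← hi] at hi2 hfb
    have hi2' : (2 : ℝ) ≤ i := by exact_mod_cast hi2
    have hfb' : (isingFit u : ℝ) + i = n := by exact_mod_cast hfb
    have hX : 2 * n - popFit u (fun i => !u i) = 2 * (i : ℝ) := by
      rw [popFit_not hn]; linarith
    have hΔ : 1024 * (n : ℝ) ^ 2 / (2 * (i : ℝ)) ^ 2 = 256 * n ^ 2 / i ^ 2 := by
      field_simp
      norm_num
    have hbonus : ∀ j₁ ∈ bad u, ∀ j₂ ∈ bad u, j₁ ≠ j₂ →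
        mutPot s (twoPoint u (fun i => !u i) (cut j₁) (cut j₂) false)
          (twoPoint u (fun i => !u i) (cut j₁) (cut j₂) true) +
          ENNReal.ofReal (16 * n ^ 2 / i ^ 2) ≤ pot n s := by
      intro j₁ h1 j₂ h2 h12
      have hc := cross_pop hn u j₁ j₂ h12 h1 h2
      set z₀ := twoPoint u (fun i => !u i) (cut j₁) (cut j₂) false
      set z₁ := twoPoint u (fun i => !u i) (cut j₁) (cut j₂) true
      have g1 := hgood z₀ z₁ (256 * n ^ 2 / i ^ 2) (by positivity) (by
          have := gam_nonneg (n := n) hx4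
          have h3 : 256 * (n : ℝ) ^ 2 / i ^ 2 ≤ 64 * n ^ 2 := by
            rw [div_le_iff₀ (by positivity)]
            nlinarith [mul_le_mul_of_nonneg_left (by nlinarith : (4 : ℝ) ≤ (i : ℝ) ^ 2)
              (by positivity : 0 ≤ 64 * (n : ℝ) ^ 2)]
          have h4 : 0 ≤ 256 * (n : ℝ) * (2 * n - popFit u (fun i => !u i)) :=
            mul_nonneg (by positivity) (by linarith)
          nlinarith [sq_nonneg (n : ℝ)]) (by
          intro x h4 hx
          rw [hX, ← hΔ]
          exact gam_drop h4 (by linarith))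
      have g2 := mutPot_le hn s _ hall z₀ z₁ z₀ z₁ _ g1
      refine le_trans (add_le_add le_rfl ?_) g2
      refine le_trans (le_of_eq ?_) (mul_le_mul_left (mul_le_mul' (mut_self hn he z₀) (mut_self hn he z₁)) _)
      rw [← ENNReal.ofReal_mul (by positivity), ← ENNReal.ofReal_mul (by positivity)]
      congr 1
      ring
    let T : Finset (Fin (n + 1) × Fin (n + 1)) :=
      (bad u).offDiag.image fun p => (cut p.1, cut p.2)
    have hT : T.card = i * i - i := by
      rw [Finset.card_image_of_injective, Finset.offDiag_card, ← hi]
      rintro ⟨a, b⟩ ⟨c, d⟩ h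
      simp only [cut, Prod.mk.injEq, Fin.succ_inj] at h
      rw [h.1, h.2]
    have hb2 : ∀ c₁ c₂ : Fin (n + 1),
        mutPot s (twoPoint u (fun i => !u i) c₁ c₂ false) (twoPoint u (fun i => !u i) c₁ c₂ true) +
          (if (c₁, c₂) ∈ T then ENNReal.ofReal (16 * n ^ 2 / i ^ 2) else 0) ≤ pot n s := by
      intro c₁ c₂
      split_ifs with h
      · simp only [T, Finset.mem_image, Finset.mem_offDiag, Prod.mk.injEq, Prod.exists] at h
        obtain ⟨a, b, ⟨h1, h2, h3⟩, rfl, rfl⟩ := h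
        exact hbonus a h1 b h2 h3
      · simpa using hall' _ _
    have hsum : 1 ≤ (2 : ℝ≥0∞)⁻¹ * ∑ c₁ : Fin (n + 1), ∑ c₂ : Fin (n + 1),
        (((n : ℝ≥0∞) + 1)⁻¹ * ((n : ℝ≥0∞) + 1)⁻¹) *
          (if (c₁, c₂) ∈ T then ENNReal.ofReal (16 * n ^ 2 / i ^ 2) else 0) := by
      simp only [← Finset.mul_sum]
      rw [← Fintype.sum_prod_type' (f := fun c₁ c₂ => if (c₁, c₂) ∈ T then
        ENNReal.ofReal (16 * (n : ℝ) ^ 2 / i ^ 2) else 0)]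
      rw [Finset.sum_ite_mem, Finset.univ_inter, Finset.sum_const, hT, nsmul_eq_mul]
      have e1 : ((n : ℝ≥0∞) + 1)⁻¹ = ENNReal.ofReal (1 / ((n : ℝ) + 1)) := by
        rw [one_div, ENNReal.ofReal_inv_of_pos (by positivity), ENNReal.ofReal_add (by positivity) (by norm_num)]
        simp
      have e2 : (2 : ℝ≥0∞)⁻¹ = ENNReal.ofReal (1 / 2) := by
        rw [one_div, ENNReal.ofReal_inv_of_pos (by norm_num)]; simp
      have e3 : ((i * i - i : ℕ) : ℝ≥0∞) = ENNReal.ofReal ((i : ℝ) * i - i) := by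
        rw [← ENNReal.ofReal_natCast, Nat.cast_sub (by nlinarith)]
        push_cast
        rfl
      rw [e1, e2, e3, ← ENNReal.ofReal_mul (by positivity), ← ENNReal.ofReal_mul (by nlinarith),
        ← ENNReal.ofReal_mul (by positivity), ← ENNReal.ofReal_mul (by positivity), ← ENNReal.ofReal_one]
      apply ENNReal.ofReal_le_ofReal
      have e4 : 1 / 2 * (1 / ((n : ℝ) + 1) * (1 / (n + 1)) * (((i : ℝ) * i - i) * (16 * n ^ 2 / i ^ 2)))
          = 8 * ((i - 1) * n ^ 2) / (i * (n + 1) ^ 2) := by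
        field_simp
        ring
      rw [e4, one_le_div (by positivity)]
      have h5 : (i : ℝ) ≤ 2 * (i - 1) := by linarith
      have h6 : ((n : ℝ) + 1) ^ 2 ≤ 4 * n ^ 2 := by nlinarith
      calc (i : ℝ) * (n + 1) ^ 2 ≤ (2 * (i - 1)) * (4 * n ^ 2) := by gcongr; linarith
        _ = _ := by ring
    have hM := mul_le_mul_right (Finset.sum_le_sum fun c₁ (_ : c₁ ∈ Finset.univ) =>
      Finset.sum_le_sum fun c₂ (_ : c₂ ∈ Finset.univ) =>
        mul_le_mul_right (hb2 c₁ c₂) (((n : ℝ≥0∞) + 1)⁻¹ * ((n : ℝ≥0∞) + 1)⁻¹)) (2 : ℝ≥0∞)⁻¹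
    simp only [mul_add, Finset.sum_add_distrib] at hM
    rw [add_right_comm]
    refine add_le_add ((add_le_add le_rfl hsum).trans hM) (mul_le_mul_right (hall' _ _) _)

lemma init_pot {n : ℕ} (hn : 2 ≤ n) : ∑ s, init n s * pot n s ≤ ENNReal.ofReal (768 * n ^ 2) := by
  have hn' : (2 : ℝ) ≤ n := by exact_mod_cast hn
  have h1 : ∀ s : State n, init n s * pot n s ≤ ((2 : ℝ≥0∞) ^ (n * 2))⁻¹ *
      (if s.2 = decide (∃ i, isOpt (s.1 i)) then ENNReal.ofReal (768 * n ^ 2) else 0) := by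
    intro s
    unfold init
    split_ifs with h
    · rw [mul_one]
      refine mul_le_mul_right ?_ _
      unfold pot
      by_cases ho : ∃ i, isOpt (s.1 i)
      · rw [if_pos (by rw [h]; simpa using ho)]; exact zero_le
      · rw [if_neg (by rw [h]; simpa using ho), if_neg ho]
        apply ENNReal.ofReal_le_ofReal
        push Not at ho
        have a := popFit_le hn _ _ (ho 0) (ho 1)
        have b := popFit_nonneg (s.1 0) (s.1 1)
        unfold gam
        have c : 1 - 1 / (2 * n - popFit (s.1 0) (s.1 1)) ≤ 1 := by
          have : 0 ≤ 1 / (2 * n - popFit (s.1 0) (s.1 1)) := one_div_nonneg.2 (by linarith)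
          linarith
        have d := mul_le_mul_of_nonneg_left c (by positivity : 0 ≤ 256 * (n : ℝ) ^ 2)
        nlinarith
    · simp
  refine (Finset.sum_le_sum fun s _ => h1 s).trans ?_
  rw [← Finset.mul_sum, Fintype.sum_prod_type]
  have hin : ∀ P : Fin 2 → BitString n, ∑ b : Bool,
      (if b = decide (∃ i, isOpt (P i)) then ENNReal.ofReal (768 * (n : ℝ) ^ 2) else 0) =
      ENNReal.ofReal (768 * (n : ℝ) ^ 2) := by
    intro P
    rw [Fintype.sum_bool]
    generalize decide (∃ i, isOpt (P i)) = d
    cases d <;> simp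
  rw [Finset.sum_congr rfl fun P _ => hin P, Finset.sum_const, Finset.card_univ, nsmul_eq_mul]
  rw [← mul_assoc]
  have hc : ((Fintype.card (Fin 2 → BitString n) : ℕ) : ℝ≥0∞) = 2 ^ (n * 2) := by
    simp [pow_mul]
  rw [hc, ENNReal.inv_mul_cancel (by simp) (by simp), one_mul]

/-- Fischer–Wegener: the expected number of fitness evaluations
(two for the initial population and two per generation) until the (2+2) GA with
two-point crossover (crossover probability 1/2) and fitness sharing finds a global
optimum of the Ising model / 2-coloring problem on the ring with an even number n of
vertices is O(n²). -/
theorem twoPlusTwoGA_Ising_ring_sharing :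
    ∃ C : ℝ, 0 < C ∧ ∀ᶠ n : ℕ in atTop, Even n →
      2 + 2 * expGens n ≤ ENNReal.ofReal (C * (n : ℝ) ^ 2) := by
  refine ⟨1538, by norm_num, ?_⟩
  filter_upwards [eventually_ge_atTop 2] with n hn he
  have h : expGens n ≤ ENNReal.ofReal (768 * n ^ 2) :=
    (lyapunov (init n) (trans n) _ (pot n) (fun s => by
      convert drift hn he s)).trans (init_pot hn)
  have hn' : (2 : ℝ) ≤ n := by exact_mod_cast hn
  calc 2 + 2 * expGens n ≤ 2 + 2 * ENNReal.ofReal (768 * n ^ 2) := by gcongr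
    _ = ENNReal.ofReal (2 + 2 * (768 * n ^ 2)) := by
        rw [ENNReal.ofReal_add (by norm_num) (by positivity), ENNReal.ofReal_mul (by norm_num)]
        simp
    _ ≤ _ := ENNReal.ofReal_le_ofReal (by nlinarith)

end Stmt16
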